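/- Let A = (a,b) be a dominant B_{m|n}-datum of atypicality k. Then A is stable if and only if the multiset {|a_i| : m−k < i ≤ m} equals the multiset {b_j : n−k < j ≤ n} and, in addition, it is not the case that 1/2 is simultaneously a ×-value and a core value of A (equivalently: if min(mult_a(1/2), mult_b(1/2)) ≥ 1 then mult_a(1/2) = mult_b(1/2)). (This is the stability criterion of Section 5.2.1 of the paper: a dominant weight λ of atypicality k is stable if and only if core(λ) = Σ_{i≤m−k} a_i ε_i + Σ_{j≤n−k} b_j δ_j.) -/

import Mathlib

/-!
Statement 4: the stability criterion of Section 5.2.1 for a dominant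
`B_{m|n}`-datum of atypicality `k`.
-/

namespace GorelikHeidersdorfB

open Finset

/-- The ambient weight space `ℚ^m × ℚ^n`. -/
abbrev V (m n : ℕ) := (Fin m → ℚ) × (Fin n → ℚ)

/-- The basis vector `ε_i` (1-indexed); `0` when `i` is out of range. -/
def eps (m n : ℕ) (i : ℕ) : V m n :=
  (fun j => if (j : ℕ) + 1 = i then 1 else 0, 0)

/-- The basis vector `δ_j` (1-indexed); `0` when `j` is out of range. -/
def delta (m n : ℕ) (j : ℕ) : V m n :=
  (0, fun k => if (k : ℕ) + 1 = j then 1 else 0)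

/-- The sequence `u_1, …, u_{m+n}` for `osp(2m+1|2n)`: for `m ≥ n` it is
`ε_1, …, ε_{m-n+1}, δ_1, ε_{m-n+2}, δ_2, …, ε_m, δ_n`, and for `n > m` it is
`δ_1, …, δ_{n-m}, ε_1, δ_{n-m+1}, ε_2, …, ε_m, δ_n`. -/
def uB (m n : ℕ) (t : ℕ) : V m n :=
  if n ≤ m then
    if t ≤ m - n + 1 then eps m n t
    else if (t - (m - n + 1)) % 2 = 1 then delta m n ((t - (m - n + 1) + 1) / 2)
    else eps m n (m - n + 1 + (t - (m - n + 1)) / 2)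
  else
    if t ≤ n - m then delta m n t
    else if (t - (n - m)) % 2 = 1 then eps m n ((t - (n - m) + 1) / 2)
    else delta m n (n - m + (t - (n - m)) / 2)

/-- The simple roots `Σ` of `osp(2m+1|2n)`, indexed by `1 ≤ t ≤ m+n`:
for `t ≤ m+n-1` the root `u_t - u_{t+1}`, and for `t = m+n` the root `δ_n`. -/
def rootB (m n : ℕ) (t : ℕ) : V m n :=
  if t ≤ m + n - 1 then uB m n t - uB m n (t + 1) else delta m n n

/-- `B ≤ A` : the difference `A - B` is a linear combination of elements of `Σ`
with non-negative integer coefficients. -/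
def leB (m n : ℕ) (B A : V m n) : Prop :=
  ∃ c : ℕ → ℕ, A - B = ∑ t ∈ Finset.Icc 1 (m + n), (c t : ℚ) • rootB m n t

/-- `(a, b)` is a `B_{m|n}`-datum: every `a i + 1/2` and every `b j - 1/2` is a
non-negative integer. -/
def IsBDatum {m n : ℕ} (a : Fin m → ℚ) (b : Fin n → ℚ) : Prop :=
  (∀ i, ∃ k : ℕ, a i + 1/2 = k) ∧ (∀ j, ∃ k : ℕ, b j - 1/2 = k)

/-- `mult_a(v) = #{i : |a_i| = v}`. -/
def multA {m : ℕ} (a : Fin m → ℚ) (v : ℚ) : ℕ :=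
  (univ.filter fun i => |a i| = v).card

/-- `mult_b(v) = #{j : b_j = v}`. -/
def multB {n : ℕ} (b : Fin n → ℚ) (v : ℚ) : ℕ :=
  (univ.filter fun j => b j = v).card

/-- Dominance for a `B_{m|n}`-datum. -/
def BDominant {m n : ℕ} (a : Fin m → ℚ) (b : Fin n → ℚ) : Prop :=
  (∀ i j : Fin m, i ≤ j → a j ≤ a i) ∧
  (∀ i j : Fin m, i < j → a i = a j → a i = -(1/2)) ∧
  (∀ i j : Fin n, i ≤ j → b j ≤ b i) ∧
  (∀ i j : Fin n, i < j → b i = b j → b i = 1/2) ∧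
  (multA a (1/2) ≤ multB b (1/2) + 1 ∧ multB b (1/2) ≤ multA a (1/2) + 1)

/-- `v` is a `×`-value. -/
def IsCrossValue {m n : ℕ} (a : Fin m → ℚ) (b : Fin n → ℚ) (v : ℚ) : Prop :=
  1 ≤ min (multA a v) (multB b v)

/-- `v` is a `>`-value. -/
def IsGtValue {m n : ℕ} (a : Fin m → ℚ) (b : Fin n → ℚ) (v : ℚ) : Prop :=
  multB b v < multA a v

/-- `v` is a `<`-value. -/
def IsLtValue {m n : ℕ} (a : Fin m → ℚ) (b : Fin n → ℚ) (v : ℚ) : Prop :=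
  multA a v < multB b v

/-- `v` is a core value. -/
def IsCoreValue {m n : ℕ} (a : Fin m → ℚ) (b : Fin n → ℚ) (v : ℚ) : Prop :=
  IsGtValue a b v ∨ IsLtValue a b v

/-- Two data have equal core: the same `>`-values and the same `<`-values. -/
def EqualCore {m n m' n' : ℕ} (a : Fin m → ℚ) (b : Fin n → ℚ)
    (a' : Fin m' → ℚ) (b' : Fin n' → ℚ) : Prop :=
  (∀ v, IsGtValue a b v ↔ IsGtValue a' b' v) ∧
  (∀ v, IsLtValue a b v ↔ IsLtValue a' b' v)

/-- Stability: every `×`-value is strictly smaller than every core value. -/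
def BStable {m n : ℕ} (a : Fin m → ℚ) (b : Fin n → ℚ) : Prop :=
  ∀ v w, IsCrossValue a b v → IsCoreValue a b w → v < w


/-- The atypicality `k = Σ_v min(mult_a(v), mult_b(v))` (the sum over all values
`v`, which is supported on the values of `|a_i|` and of `b_j`). -/
def atypicality {m n : ℕ} (a : Fin m → ℚ) (b : Fin n → ℚ) : ℕ :=
  ∑ v ∈ (univ.image fun i => |a i|) ∪ (univ.image b),
    min (multA a v) (multB b v)

/-- The multiset of the last `k` values of a finite sequence. -/
def tailValues {m : ℕ} (f : Fin m → ℚ) (k : ℕ) : Multiset ℚ :=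
  (univ.filter fun i : Fin m => m - k ≤ (i : ℕ)).val.map f

theorem card_filter_sub_le {m k : ℕ} (hk : k ≤ m) :
    (univ.filter fun i : Fin m => m - k ≤ (i : ℕ)).card = k := by
  rw [Finset.card_filter, Fin.sum_univ_eq_sum_range (fun i => if m - k ≤ i then 1 else 0) m,
    ← Finset.card_filter]
  have : (range m).filter (fun i => m - k ≤ i) = Finset.Ico (m - k) m := by
    ext i
    simp only [Finset.mem_filter, Finset.mem_range, Finset.mem_Ico]
    tauto
  rw [this, Nat.card_Ico]
  omega

theorem eq_filter_sub_card_le_of_isUpperSet {m : ℕ} {U : Finset (Fin m)}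
    (hU : IsUpperSet (U : Set (Fin m))) :
    U = univ.filter fun i : Fin m => m - U.card ≤ (i : ℕ) := by
  have hm : U.card ≤ m := by simpa using U.card_le_univ
  refine Finset.eq_of_subset_of_card_le (fun i hi => ?_) (card_filter_sub_le hm).le
  have hsub : Finset.Ici i ⊆ U := fun j hj => hU (Finset.mem_Ici.1 hj) hi
  have hcard := Finset.card_le_card hsub
  rw [Fin.card_Ici] at hcard
  simp only [Finset.mem_filter, Finset.mem_univ, true_and]
  omega

theorem tailValues_le {m : ℕ} (f : Fin m → ℚ) (k : ℕ) :
    tailValues f k ≤ univ.val.map f :=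
  Multiset.map_le_map (Finset.val_le_iff.2 (Finset.filter_subset _ _))

theorem card_tailValues {m k : ℕ} (f : Fin m → ℚ) (hk : k ≤ m) :
    (tailValues f k).card = k := by
  rw [tailValues, Multiset.card_map, Finset.card_val, card_filter_sub_le hk]

theorem tailValues_card_eq {m : ℕ} {f : Fin m → ℚ} (hf : Antitone f) {I : Multiset ℚ}
    (hcount : ∀ v ∈ I, I.count v = (univ.val.map f).count v)
    (hlt : ∀ v ∈ I, ∀ i, f i ∉ I → v < f i) :
    tailValues f I.card = I := by
  have hfilter : (univ.filter fun i => f i ∈ I).val.map f = I := by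
    refine (Multiset.filter_map (· ∈ I) f univ.val).symm.trans ?_
    ext v
    by_cases hv : v ∈ I
    · rw [Multiset.count_filter_of_pos (p := (· ∈ I)) hv, hcount v hv]
    · rw [Multiset.count_filter_of_neg (p := (· ∈ I)) hv, Multiset.count_eq_zero_of_notMem hv]
  have hupper : IsUpperSet ((univ.filter fun i => f i ∈ I : Finset (Fin m)) : Set (Fin m)) := by
    intro i j hij hi
    simp only [Finset.coe_filter, Finset.mem_univ, true_and, Set.mem_ofPred_eq] at hi ⊢
    by_contra hj
    exact (hlt _ hi j hj).not_ge (hf hij)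
  have hcard : (univ.filter fun i => f i ∈ I).card = I.card := by
    conv_rhs => rw [← hfilter]
    rw [Multiset.card_map, Finset.card_val]
  have heq := eq_filter_sub_card_le_of_isUpperSet hupper
  rw [hcard] at heq
  rw [tailValues, ← heq, hfilter]

theorem le_of_mem_tailValues {m k : ℕ} {f : Fin m → ℚ} (hf : Antitone f) {v w : ℚ}
    (hv : v ∈ tailValues f k) (hw : (tailValues f k).count w < (univ.val.map f).count w) :
    v ≤ w := by
  obtain ⟨i, hi, rfl⟩ := Multiset.mem_map.1 hv
  have hi : m - k ≤ (i : ℕ) := by simpa using hi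
  by_contra! hlt
  refine hw.not_ge ?_
  rw [tailValues, Multiset.count_map, Multiset.count_map, ← Finset.filter_val,
    ← Finset.filter_val, Finset.card_val, Finset.card_val]
  refine Finset.card_le_card fun j hj => ?_
  simp only [Finset.mem_filter, Finset.mem_univ, true_and] at hj ⊢
  refine ⟨?_, hj⟩
  by_contra! hjk
  have : f i ≤ f j := hf (Fin.le_def.2 (by omega))
  exact (hlt.trans_le this).ne hj

theorem multB_eq_count {n : ℕ} (b : Fin n → ℚ) (v : ℚ) :
    multB b v = (univ.val.map b).count v := by
  simp only [multB, Multiset.count_map, ← Finset.filter_val, Finset.card_val, eq_comm]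

theorem multA_eq_count {m : ℕ} (a : Fin m → ℚ) (v : ℚ) :
    multA a v = (univ.val.map fun i => |a i|).count v :=
  multB_eq_count (fun i => |a i|) v

theorem atypicality_eq_card_inter {m n : ℕ} (a : Fin m → ℚ) (b : Fin n → ℚ) :
    atypicality a b = ((univ.val.map fun i => |a i|) ∩ univ.val.map b).card := by
  simp only [atypicality, multA_eq_count, multB_eq_count, ← Multiset.count_inter]
  refine Multiset.sum_count_eq_card fun v hv => ?_
  obtain ⟨i, -, rfl⟩ := Multiset.mem_map.1 (Multiset.mem_inter.1 hv).1
  exact Finset.mem_union_left _ (Finset.mem_image_of_mem _ (Finset.mem_univ i))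

theorem isCrossValue_iff_mem_inter {m n : ℕ} {a : Fin m → ℚ} {b : Fin n → ℚ} {v : ℚ} :
    IsCrossValue a b v ↔ v ∈ (univ.val.map fun i => |a i|) ∩ univ.val.map b := by
  rw [IsCrossValue, multA_eq_count, multB_eq_count, ← Multiset.count_inter,
    Multiset.one_le_count_iff_mem]

theorem isCoreValue_iff_ne {m n : ℕ} {a : Fin m → ℚ} {b : Fin n → ℚ} {v : ℚ} :
    IsCoreValue a b v ↔ multA a v ≠ multB b v := by
  simp only [IsCoreValue, IsGtValue, IsLtValue]
  omega

theorem IsBDatum.eq_neg_half_or_half_le {m n : ℕ} {a : Fin m → ℚ} {b : Fin n → ℚ} (h : IsBDatum a b)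
    (i : Fin m) : a i = -(1/2) ∨ 1/2 ≤ a i := by
  obtain ⟨k, hk⟩ := h.1 i
  rcases k with _ | k
  · left
    push_cast at hk
    linarith
  · right
    push_cast at hk
    have : (0 : ℚ) ≤ k := k.cast_nonneg
    linarith

theorem BDominant.antitone_abs {m n : ℕ} {a : Fin m → ℚ} {b : Fin n → ℚ}
    (hdom : BDominant a b) (h : IsBDatum a b) : Antitone fun i => |a i| := by
  intro i j hij
  have hle := hdom.1 i j hij
  change |a j| ≤ |a i|
  rcases h.eq_neg_half_or_half_le i with hi | hi <;> rcases h.eq_neg_half_or_half_le j with hj | hj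
  · rw [hi, hj]
  · linarith
  · rw [hj, abs_neg, abs_of_pos (by norm_num)]
    exact hi.trans (le_abs_self _)
  · rwa [abs_of_nonneg (by linarith), abs_of_nonneg (by linarith)]

theorem BDominant.multA_le_one {m n : ℕ} {a : Fin m → ℚ} {b : Fin n → ℚ}
    (hdom : BDominant a b) (h : IsBDatum a b) {v : ℚ} (hv : v ≠ 1/2) : multA a v ≤ 1 := by
  have hval : ∀ i, |a i| = v → a i = v := by
    intro i hi
    rcases h.eq_neg_half_or_half_le i with h' | h'
    · rw [h', abs_neg, abs_of_pos (by norm_num)] at hi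
      exact absurd hi.symm hv
    · rwa [abs_of_nonneg (by linarith)] at hi
  have hne : ∀ i j, |a i| = v → |a j| = v → ¬ i < j := by
    intro i j hi hj hij
    have := hdom.2.1 i j hij ((hval i hi).trans (hval j hj).symm)
    rw [this, abs_neg, abs_of_pos (by norm_num)] at hi
    exact hv hi.symm
  refine Finset.card_le_one.2 fun i hi j hj => ?_
  simp only [Finset.mem_filter, Finset.mem_univ, true_and] at hi hj
  exact le_antisymm (not_lt.1 (hne j i hj hi)) (not_lt.1 (hne i j hi hj))

theorem BDominant.multB_le_one {m n : ℕ} {a : Fin m → ℚ} {b : Fin n → ℚ}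
    (hdom : BDominant a b) {v : ℚ} (hv : v ≠ 1/2) : multB b v ≤ 1 := by
  have hne : ∀ i j, b i = v → b j = v → ¬ i < j := fun i j hi hj hij =>
    hv (hi ▸ hdom.2.2.2.1 i j hij (hi.trans hj.symm))
  refine Finset.card_le_one.2 fun i hi j hj => ?_
  simp only [Finset.mem_filter, Finset.mem_univ, true_and] at hi hj
  exact le_antisymm (not_lt.1 (hne j i hj hi)) (not_lt.1 (hne i j hi hj))

theorem BDominant.eq_half_of_isCrossValue_of_isCoreValue {m n : ℕ} {a : Fin m → ℚ}
    {b : Fin n → ℚ} (hdom : BDominant a b) (h : IsBDatum a b) {v : ℚ}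
    (hcross : IsCrossValue a b v) (hcore : IsCoreValue a b v) : v = 1/2 := by
  by_contra hv
  have ha := hdom.multA_le_one h hv
  have hb := hdom.multB_le_one hv
  rw [isCoreValue_iff_ne] at hcore
  rw [IsCrossValue, le_min_iff] at hcross
  omega

theorem BStable.tailValues_eq {m n : ℕ} {a : Fin m → ℚ} {b : Fin n → ℚ}
    (hst : BStable a b) (ha : Antitone fun i => |a i|) (hb : Antitone b) :
    tailValues (fun i => |a i|) (atypicality a b) = tailValues b (atypicality a b) := by
  have heq : ∀ v, IsCrossValue a b v → multA a v = multB b v := fun v hv => by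
    by_contra hne
    exact lt_irrefl v (hst v v hv (isCoreValue_iff_ne.2 hne))
  have hcore : ∀ w, ¬ IsCrossValue a b w → 1 ≤ multA a w ∨ 1 ≤ multB b w →
      IsCoreValue a b w := fun w hw hpos => by
    rw [isCoreValue_iff_ne]
    rw [IsCrossValue, le_min_iff] at hw
    omega
  rw [atypicality_eq_card_inter]
  trans (univ.val.map fun i => |a i|) ∩ univ.val.map b
  · refine tailValues_card_eq ha (fun v hv => ?_) fun v hv i hi => ?_
    · have := heq v (isCrossValue_iff_mem_inter.2 hv)
      rw [Multiset.count_inter, ← multA_eq_count, ← multB_eq_count, this, min_self]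
    · refine hst v _ (isCrossValue_iff_mem_inter.2 hv)
        (hcore _ (mt isCrossValue_iff_mem_inter.1 hi) (Or.inl ?_))
      rw [multA_eq_count, Multiset.one_le_count_iff_mem]
      exact Multiset.mem_map_of_mem (fun i => |a i|) (Finset.mem_univ i)
  · refine (tailValues_card_eq hb (fun v hv => ?_) fun v hv i hi => ?_).symm
    · have := heq v (isCrossValue_iff_mem_inter.2 hv)
      rw [Multiset.count_inter, ← multA_eq_count, ← multB_eq_count, this, min_self]
    · refine hst v _ (isCrossValue_iff_mem_inter.2 hv)
        (hcore _ (mt isCrossValue_iff_mem_inter.1 hi) (Or.inr ?_))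
      rw [multB_eq_count, Multiset.one_le_count_iff_mem]
      exact Multiset.mem_map_of_mem b (Finset.mem_univ i)

theorem tailValues_eq_inter {m n : ℕ} {a : Fin m → ℚ} {b : Fin n → ℚ}
    (h : tailValues (fun i => |a i|) (atypicality a b) = tailValues b (atypicality a b)) :
    tailValues b (atypicality a b) = (univ.val.map fun i => |a i|) ∩ univ.val.map b := by
  have hle : atypicality a b ≤ n := by
    rw [atypicality_eq_card_inter]
    simpa using Multiset.card_le_card (Multiset.inter_le_right
      (s := univ.val.map fun i => |a i|) (t := univ.val.map b))
  refine Multiset.eq_of_le_of_card_le (Multiset.le_inter (h ▸ tailValues_le _ _)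
    (tailValues_le _ _)) ?_
  rw [card_tailValues b hle, atypicality_eq_card_inter]

theorem le_of_tailValues_eq {m n : ℕ} {a : Fin m → ℚ} {b : Fin n → ℚ}
    (ha : Antitone fun i => |a i|) (hb : Antitone b)
    (h : tailValues (fun i => |a i|) (atypicality a b) = tailValues b (atypicality a b))
    {v w : ℚ} (hv : IsCrossValue a b v) (hw : IsCoreValue a b w) : v ≤ w := by
  have hinter := tailValues_eq_inter h
  rw [isCrossValue_iff_mem_inter] at hv
  simp only [IsCoreValue, IsGtValue, IsLtValue, multA_eq_count, multB_eq_count] at hw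
  rcases hw with hw | hw
  · refine le_of_mem_tailValues ha (k := atypicality a b) ?_ ?_
    · rwa [h, hinter]
    · rw [h, hinter, Multiset.count_inter]
      exact min_lt_of_right_lt hw
  · refine le_of_mem_tailValues hb (k := atypicality a b) ?_ ?_
    · rwa [hinter]
    · rw [hinter, Multiset.count_inter]
      exact min_lt_of_left_lt hw

/-- **Stability criterion** (Section 5.2.1): a dominant `B_{m|n}`-datum of
atypicality `k` is stable iff the multiset `{|a_i| : m-k < i ≤ m}` equals the
multiset `{b_j : n-k < j ≤ n}` and `1/2` is not simultaneously a `×`-value and a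
core value. -/
theorem BStable_iff (m n : ℕ) (a : Fin m → ℚ) (b : Fin n → ℚ)
    (hdatum : IsBDatum a b) (hdom : BDominant a b) :
    BStable a b ↔
      (((univ.filter fun i : Fin m => m - atypicality a b ≤ (i : ℕ)).val.map
          fun i => |a i|) =
        ((univ.filter fun j : Fin n => n - atypicality a b ≤ (j : ℕ)).val.map
          fun j => b j) ∧
        ¬(IsCrossValue a b (1/2) ∧ IsCoreValue a b (1/2))) := by
  have ha := hdom.antitone_abs hdatum
  have hb : Antitone b := hdom.2.2.1
  constructor
  · intro hst
    exact ⟨hst.tailValues_eq ha hb, fun ⟨hcross, hcore⟩ => lt_irrefl _ (hst _ _ hcross hcore)⟩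
  · rintro ⟨htail, hhalf⟩ v w hv hw
    refine (le_of_tailValues_eq ha hb htail hv hw).lt_of_ne ?_
    rintro rfl
    obtain rfl := hdom.eq_half_of_isCrossValue_of_isCoreValue hdatum hv hw
    exact hhalf ⟨hv, hw⟩

end GorelikHeidersdorfB
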